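/- Let ν ∈ (0,1), let m be a nonzero real number, and let κ : ℝ → ℝ satisfy κ(0) = 0 and κ(u)/u → m as u → 0 with u ≠ 0. Let a : (0,∞) → (0,∞) satisfy a(t) → 0 and t·a(t) → ∞ as t → ∞. Then for every real θ, lim_{t→∞} a(t) · log E_ν( κ( θ · (a(t)·t)^{−ν} ) · t^ν ) = (max(mθ, 0))^{1/ν}, i.e. the limit equals (mθ)^{1/ν} if mθ ≥ 0 and equals 0 if mθ < 0. -/

import Mathlib

open Filter

noncomputable def mittagLeffler (ν x : ℝ) : ℝ := ∑' k : ℕ, x ^ k / Real.Gamma (ν * k + 1)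

open MeasureTheory Set Topology

section MittagLefflerSeries

lemma rpow_div_Gamma_add_one_le_exp {s t : ℝ} (hs : 0 ≤ s) (ht : 0 ≤ t) :
    t ^ s / Real.Gamma (s + 1) ≤ Real.exp t := by
  have hG : 0 < Real.Gamma (s + 1) := Real.Gamma_pos_of_pos (by linarith)
  rw [div_le_iff₀ hG]
  have hint : IntegrableOn (fun x : ℝ => Real.exp (-x) * x ^ s) (Ioi 0) := by
    simpa using Real.GammaIntegral_convergent (s := s + 1) (by linarith)
  have key : Real.exp (-t) * t ^ s ≤ Real.Gamma (s + 1) := by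
    rw [Real.Gamma_eq_integral (by linarith), add_sub_cancel_right]
    calc Real.exp (-t) * t ^ s = ∫ x in Ioi t, Real.exp (-x) * t ^ s := by
          rw [integral_mul_const, integral_exp_neg_Ioi]
      _ ≤ ∫ x in Ioi t, Real.exp (-x) * x ^ s := by
          refine setIntegral_mono_on ?_ (hint.mono_set (Ioi_subset_Ioi ht)) measurableSet_Ioi ?_
          · exact (integrableOn_exp_neg_Ioi t).mul_const _
          · intro x hx
            have : t < x := hx
            gcongr
      _ ≤ ∫ x in Ioi 0, Real.exp (-x) * x ^ s := by
          refine setIntegral_mono_set hint ?_ (Ioi_subset_Ioi ht).eventuallyLE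
          filter_upwards [ae_restrict_mem measurableSet_Ioi] with x hx
          have : 0 < x := hx
          simp only [Pi.zero_apply]
          positivity
  calc t ^ s = Real.exp t * (Real.exp (-t) * t ^ s) := by
        rw [← mul_assoc, ← Real.exp_add]; simp
    _ ≤ _ := by gcongr

variable {ν : ℝ}

lemma Gamma_mul_natCast_add_one_pos (hν : 0 < ν) (k : ℕ) : 0 < Real.Gamma (ν * k + 1) :=
  Real.Gamma_pos_of_pos (by positivity)

lemma rpow_pow_div_Gamma_le (hν : 0 < ν) {b y : ℝ} (hb : 0 < b) (hy : 0 ≤ y) (k : ℕ) :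
    (y ^ ν) ^ k / Real.Gamma (ν * k + 1) ≤ Real.exp (b * y) * (b ^ (-ν)) ^ k := by
  have h := rpow_div_Gamma_add_one_le_exp (s := ν * k) (t := b * y) (by positivity) (by positivity)
  have hb' : (0 : ℝ) < (b ^ (-ν)) ^ k := by positivity
  have e : (y ^ ν) ^ k = (b * y) ^ (ν * k) * (b ^ (-ν)) ^ k := by
    rw [Real.mul_rpow hb.le hy, Real.rpow_neg hb.le, Real.rpow_mul hb.le, Real.rpow_mul hy,
      Real.rpow_natCast, Real.rpow_natCast, inv_pow]
    field_simp
  rw [e, mul_div_right_comm]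
  gcongr

lemma rpow_neg_lt_one (hν : 0 < ν) {b : ℝ} (hb : 1 < b) : b ^ (-ν) < 1 :=
  Real.rpow_lt_one_of_one_lt_of_neg hb (by linarith)

lemma summable_mittagLeffler (hν : 0 < ν) (x : ℝ) :
    Summable fun k : ℕ => x ^ k / Real.Gamma (ν * k + 1) := by
  have hx : (|x| ^ (1 / ν)) ^ ν = |x| := by
    rw [← Real.rpow_mul (abs_nonneg x), one_div_mul_cancel hν.ne', Real.rpow_one]
  refine Summable.of_norm_bounded (g := fun k : ℕ =>
    Real.exp (2 * |x| ^ (1 / ν)) * ((2 : ℝ) ^ (-ν)) ^ k) ?_ fun k => ?_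
  · exact (summable_geometric_of_lt_one (by positivity)
      (rpow_neg_lt_one hν one_lt_two)).mul_left _
  · have := rpow_pow_div_Gamma_le hν two_pos (by positivity : 0 ≤ |x| ^ (1 / ν)) k
    rwa [hx, ← abs_pow, ← abs_of_pos (Gamma_mul_natCast_add_one_pos hν k), ← abs_div] at this

lemma hasSum_mittagLeffler (hν : 0 < ν) (x : ℝ) :
    HasSum (fun k : ℕ => x ^ k / Real.Gamma (ν * k + 1)) (mittagLeffler ν x) :=
  (summable_mittagLeffler hν x).hasSum

lemma mittagLeffler_zero (hν : 0 < ν) : mittagLeffler ν 0 = 1 := by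
  refine (hasSum_mittagLeffler hν 0).unique ?_
  convert hasSum_single (f := fun k : ℕ => (0 : ℝ) ^ k / Real.Gamma (ν * k + 1)) 0 ?_ using 1
  · simp
  · intro k hk
    simp [hk]

lemma continuous_mittagLeffler (hν : 0 < ν) : Continuous (mittagLeffler ν) := by
  refine continuous_iff_continuousAt.2 fun x => ?_
  have h : ContinuousOn (mittagLeffler ν) (Metric.ball 0 (|x| + 1)) := by
    refine continuousOn_tsum (u := fun k : ℕ => (|x| + 1) ^ k / Real.Gamma (ν * k + 1))
      (fun k => by fun_prop) (summable_mittagLeffler hν _) fun k y hy => ?_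
    have hy' : |y| ≤ |x| + 1 := by simpa using (mem_ball_zero_iff.1 hy).le
    rw [norm_div, norm_pow, Real.norm_eq_abs, Real.norm_eq_abs,
      abs_of_pos (Gamma_mul_natCast_add_one_pos hν k)]
    have := Gamma_mul_natCast_add_one_pos hν k
    gcongr
  exact h.continuousAt (Metric.isOpen_ball.mem_nhds (by simp))

lemma one_le_mittagLeffler (hν : 0 < ν) {x : ℝ} (hx : 0 ≤ x) : 1 ≤ mittagLeffler ν x := by
  have := (summable_mittagLeffler hν x).le_tsum 0 fun k _ =>
    div_nonneg (pow_nonneg hx k) (Gamma_mul_natCast_add_one_pos hν k).le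
  simpa [mittagLeffler] using this

lemma mittagLeffler_rpow_le (hν : 0 < ν) {b y : ℝ} (hb : 1 < b) (hy : 0 ≤ y) :
    mittagLeffler ν (y ^ ν) ≤ Real.exp (b * y) * (1 - b ^ (-ν))⁻¹ :=
  hasSum_le (fun k => rpow_pow_div_Gamma_le hν (by linarith) hy k) (hasSum_mittagLeffler hν _)
    ((hasSum_geometric_of_lt_one (by positivity) (rpow_neg_lt_one hν hb)).mul_left _)

lemma exp_le_mul_mittagLeffler (hν : 0 < ν) (hν1 : ν < 1) {y : ℝ} (hy : 1 ≤ y) :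
    Real.exp y ≤ (1 + y) * mittagLeffler ν (y ^ ν) := by
  have hy0 : 0 ≤ y := by linarith
  let φ : ℕ → ℕ := fun n => ⌈n / ν⌉₊
  have hlow (n : ℕ) : (n : ℝ) ≤ ν * φ n := by
    have := Nat.le_ceil (n / ν)
    rwa [div_le_iff₀' hν] at this
  have hup (n : ℕ) : ν * φ n < n + 1 := by
    have := Nat.ceil_lt_add_one (a := n / ν) (by positivity)
    have h2 : ν * φ n < ν * (n / ν + 1) := by gcongr
    rw [mul_add, mul_div_cancel₀ _ hν.ne'] at h2
    linarith
  have hinj : Function.Injective φ := by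
    intro n k h
    have h1 : (n : ℝ) < k + 1 := by linarith [hlow n, hup k, congrArg (fun j : ℕ => ν * (j : ℝ)) h]
    have h2 : (k : ℝ) < n + 1 := by linarith [hlow k, hup n, congrArg (fun j : ℕ => ν * (j : ℝ)) h]
    norm_cast at h1 h2
    omega
  have hΓ (n : ℕ) : Real.Gamma (ν * φ n + 1) ≤ (n + 1).factorial := by
    rcases Nat.eq_zero_or_pos n with rfl | hn
    · simp [φ]
    · rw [← Real.Gamma_nat_eq_factorial]
      have hn' : (1 : ℝ) ≤ n := by exact_mod_cast hn
      refine Real.Gamma_strictMonoOn_Ici.monotoneOn ?_ ?_ ?_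
      · simp only [mem_Ici]; linarith [hlow n]
      · simp only [mem_Ici]; push_cast; linarith
      · push_cast; linarith [hup n]
  have hterm (n : ℕ) : y ^ (n + 1) / (n + 1).factorial ≤
      y * ((y ^ ν) ^ φ n / Real.Gamma (ν * φ n + 1)) := by
    rw [pow_succ', mul_div_assoc]
    have h1 : y ^ n ≤ (y ^ ν) ^ φ n := by
      rw [← Real.rpow_natCast y n, ← Real.rpow_mul_natCast hy0]
      exact Real.rpow_le_rpow_of_exponent_le hy (hlow n)
    have h2 := Gamma_mul_natCast_add_one_pos hν (φ n)
    have h3 := hΓ n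
    gcongr
  have hexp : HasSum (fun n : ℕ => y ^ n / n.factorial) (Real.exp y) := by
    rw [Real.exp_eq_exp_ℝ]
    exact NormedSpace.expSeries_div_hasSum_exp y
  have hexp' := (hasSum_nat_add_iff' 1).2 hexp
  have hs := summable_mittagLeffler hν (y ^ ν)
  have hcomp := tsum_comp_le_tsum_of_inj hs (fun k => div_nonneg (by positivity)
    (Gamma_mul_natCast_add_one_pos hν k).le) hinj
  have hle := hasSum_le hterm hexp' ((hs.comp_injective hinj).hasSum.mul_left y)
  have h1 := one_le_mittagLeffler hν (x := y ^ ν) (by positivity)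
  have h2 : y * ∑' n, ((fun k : ℕ => (y ^ ν) ^ k / Real.Gamma (ν * k + 1)) ∘ φ) n ≤
      y * mittagLeffler ν (y ^ ν) := by gcongr; exact hcomp
  simp only [Finset.range_one, Finset.sum_singleton, pow_zero, Nat.factorial_zero, Nat.cast_one,
    div_one] at hle
  linarith

end MittagLefflerSeries

section Volterra

variable {ν : ℝ}

lemma intervalIntegrable_sub_rpow (hν : 0 < ν) (t a b : ℝ) :
    IntervalIntegrable (fun s : ℝ => (t - s) ^ (ν - 1)) volume a b := by
  have h := (intervalIntegral.intervalIntegrable_rpow' (a := t - a) (b := t - b)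
    (show -1 < ν - 1 by linarith)).comp_sub_left t
  simpa using h

lemma intervalIntegrable_sub_rpow_mul (hν : 0 < ν) {f : ℝ → ℝ} (hf : Continuous f) (t a b : ℝ) :
    IntervalIntegrable (fun s : ℝ => (t - s) ^ (ν - 1) * f s) volume a b :=
  (intervalIntegrable_sub_rpow hν t a b).mul_continuousOn hf.continuousOn

lemma integral_sub_rpow (hν : 0 < ν) (a t : ℝ) :
    ∫ s in a..t, (t - s) ^ (ν - 1) = (t - a) ^ ν / ν := by
  rw [intervalIntegral.integral_comp_sub_left (fun x => x ^ (ν - 1)), sub_self,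
    integral_rpow (Or.inl (by linarith))]
  simp [Real.zero_rpow hν.ne']

/-- Solutions of the fractional relaxation equation `f = 1 - c ∫₀ᵗ (t - s) ^ (ν - 1) f s ds`. -/
structure IsRelaxation (ν c : ℝ) (f : ℝ → ℝ) : Prop where
  continuous : Continuous f
  eq_sub : ∀ t, 0 ≤ t → f t = 1 - c * ∫ s in 0..t, (t - s) ^ (ν - 1) * f s

namespace IsRelaxation

variable {c δ : ℝ} {f : ℝ → ℝ}

lemma apply_zero (hf : IsRelaxation ν c f) : f 0 = 1 := by
  simpa using hf.eq_sub 0 le_rfl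

lemma mul_apply_le (hf : IsRelaxation ν c f) (hν : 0 < ν) (hc : 0 ≤ c) {t t₀ ρ M : ℝ} (ht : 0 ≤ t)
    (htt : t ≤ t₀) (hpos : ∀ s ∈ Icc 0 t₀, 0 ≤ f s) (hM : ∀ s ∈ Icc t t₀, f s ≤ M)
    (hρ : ∀ s ∈ Ioo 0 t, (t₀ - s) ^ (ν - 1) ≤ ρ * (t - s) ^ (ν - 1)) :
    ρ * f t ≤ ρ - 1 + f t₀ + c * (M * ((t₀ - t) ^ ν / ν)) := by
  have hint := intervalIntegrable_sub_rpow_mul hν hf.continuous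
  have hA : ∫ s in 0..t, (t₀ - s) ^ (ν - 1) * f s ≤
      ρ * ∫ s in 0..t, (t - s) ^ (ν - 1) * f s := by
    rw [← intervalIntegral.integral_const_mul]
    refine intervalIntegral.integral_mono_on_of_le_Ioo ht (hint _ _ _)
      ((hint _ _ _).const_mul _) fun s hs => ?_
    rw [← mul_assoc]
    exact mul_le_mul_of_nonneg_right (hρ s hs) (hpos s ⟨hs.1.le, hs.2.le.trans htt⟩)
  have hB : ∫ s in t..t₀, (t₀ - s) ^ (ν - 1) * f s ≤ M * ((t₀ - t) ^ ν / ν) := by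
    rw [← integral_sub_rpow hν, ← intervalIntegral.integral_const_mul]
    refine intervalIntegral.integral_mono_on htt (hint _ _ _)
      ((intervalIntegrable_sub_rpow hν _ _ _).const_mul _) fun s hs => ?_
    rw [mul_comm]
    exact mul_le_mul_of_nonneg_right (hM s hs) (Real.rpow_nonneg (by linarith [hs.2]) _)
  have h₀ := hf.eq_sub t₀ (ht.trans htt)
  rw [← intervalIntegral.integral_add_adjacent_intervals (hint t₀ 0 t) (hint t₀ t t₀)] at h₀
  have h₁ := hf.eq_sub t ht
  have hA' := mul_le_mul_of_nonneg_left hA hc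
  have hB' := mul_le_mul_of_nonneg_left hB hc
  rw [h₀, h₁]
  linarith

lemma apply_le_two_mul (hf : IsRelaxation ν c f) (hν : 0 < ν) (hν1 : ν < 1) (hc : 0 ≤ c)
    (hδ : c * (δ ^ ν / ν) ≤ 1 / 2) {t t₀ : ℝ} (ht : 0 ≤ t) (htδ : t₀ - δ ≤ t) (htt : t ≤ t₀)
    (hpos : ∀ s ∈ Icc 0 t₀, 0 ≤ f s) : f t ≤ 2 * f t₀ := by
  obtain ⟨u, hu, hmax⟩ := isCompact_Icc.exists_isMaxOn (nonempty_Icc.2 htt)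
    hf.continuous.continuousOn
  have hu0 : 0 ≤ u := ht.trans hu.1
  have h := hf.mul_apply_le hν hc (ρ := 1) (M := f u) hu0 hu.2 hpos
    (fun s hs => hmax ⟨hu.1.trans hs.1, hs.2⟩) fun s hs => by
      rw [one_mul]
      exact Real.rpow_le_rpow_of_nonpos (by linarith [hs.2]) (by linarith [hu.2]) (by linarith)
  have hfu := hpos u ⟨hu0, hu.2⟩
  have hr : (t₀ - u) ^ ν ≤ δ ^ ν :=
    Real.rpow_le_rpow (by linarith [hu.2]) (by linarith [hu.1]) hν.le
  have h2 : c * ((t₀ - u) ^ ν / ν) ≤ 1 / 2 := le_trans (by gcongr) hδ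
  have h3 : f t ≤ f u := hmax ⟨le_rfl, htt⟩
  nlinarith

lemma pos (hf : IsRelaxation ν c f) (hν : 0 < ν) (hν1 : ν < 1) (hc : 0 ≤ c) (hδ0 : 0 < δ)
    (hδ : c * (δ ^ ν / ν) ≤ 1 / 2) {t : ℝ} (ht : 0 ≤ t) : 0 < f t := by
  by_contra! hneg
  let S : Set ℝ := Icc 0 t ∩ f ⁻¹' Iic 0
  have hS : IsCompact S := isCompact_Icc.inter_right (isClosed_Iic.preimage hf.continuous)
  obtain ⟨t₀, ⟨ht₀, hft₀⟩, hleast⟩ := hS.exists_isLeast ⟨t, ⟨ht, le_rfl⟩, hneg⟩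
  have hft₀' : f t₀ ≤ 0 := hft₀
  have hbefore : ∀ s, 0 ≤ s → s < t₀ → 0 < f s := by
    intro s hs hst
    by_contra! h
    exact absurd (hleast ⟨⟨hs, hst.le.trans ht₀.2⟩, h⟩) (not_le.2 hst)
  have ht₀pos : 0 < t₀ := by
    refine lt_of_le_of_ne ht₀.1 fun h => ?_
    rw [← h, hf.apply_zero] at hft₀'
    linarith
  have hzero : 0 ≤ f t₀ := by
    refine ge_of_tendsto (hf.continuous.continuousAt.tendsto.mono_left
      (nhdsWithin_le_nhds (s := Iio t₀))) ?_
    filter_upwards [Ioo_mem_nhdsLT ht₀pos] with s hs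
    exact (hbefore s hs.1.le hs.2).le
  have hlt : max (t₀ - δ) 0 < t₀ := max_lt (by linarith) ht₀pos
  have h := hf.apply_le_two_mul hν hν1 hc hδ (le_max_right (t₀ - δ) 0) (le_max_left _ _) hlt.le
    fun s hs => (lt_or_eq_of_le hs.2).elim (fun h => (hbefore s hs.1 h).le) fun h => h ▸ hzero
  have := hbefore _ (le_max_right (t₀ - δ) 0) hlt
  linarith

lemma le_one (hf : IsRelaxation ν c f) (hν : 0 < ν) (hν1 : ν < 1) (hc : 0 ≤ c) (hδ0 : 0 < δ)
    (hδ : c * (δ ^ ν / ν) ≤ 1 / 2) {t : ℝ} (ht : 0 ≤ t) : f t ≤ 1 := by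
  rw [hf.eq_sub t ht, sub_le_self_iff]
  refine mul_nonneg hc (intervalIntegral.integral_nonneg ht fun s hs => ?_)
  exact mul_nonneg (Real.rpow_nonneg (by linarith [hs.2]) _)
    (hf.pos hν hν1 hc hδ0 hδ hs.1).le

lemma div_le_apply (hf : IsRelaxation ν c f) (hν : 0 < ν) (hν1 : ν < 1) (hc : 0 ≤ c) (hδ0 : 0 < δ)
    (hδ : c * (δ ^ ν / ν) ≤ 1 / 2) {t : ℝ} (ht : δ < t) :
    (1 - ν) * δ / 2 / t ≤ f t := by
  have ht0 : 0 < t := hδ0.trans ht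
  have hpos : ∀ s ∈ Icc 0 t, 0 ≤ f s := fun s hs => (hf.pos hν hν1 hc hδ0 hδ hs.1).le
  have hu : 0 < t - δ := sub_pos.2 ht
  have h := hf.mul_apply_le hν hc (ρ := ((t - δ) / t) ^ (1 - ν)) (M := 2 * f t) hu.le
    (sub_le_self t hδ0.le) hpos
    (fun s hs => hf.apply_le_two_mul hν hν1 hc hδ (hu.le.trans hs.1) hs.1 hs.2 hpos)
    fun s hs => by
      have h1 : 0 < t - s := by linarith [hs.2]
      have h2 : 0 < t - δ - s := by linarith [hs.2]
      rw [← neg_sub 1 ν, Real.rpow_neg h1.le, Real.rpow_neg h2.le, ← Real.inv_rpow h1.le,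
        ← Real.inv_rpow h2.le, ← Real.mul_rpow (by positivity) (by positivity)]
      refine Real.rpow_le_rpow (by positivity) ?_ (by linarith)
      rw [← div_eq_mul_inv, div_div, inv_eq_one_div, div_le_div_iff₀ h1 (by positivity)]
      nlinarith [mul_pos hδ0 hs.1]
  rw [sub_sub_cancel] at h
  have hbern : ((t - δ) / t) ^ (1 - ν) ≤ 1 - (1 - ν) * (δ / t) := by
    have h1 : δ / t ≤ 1 := (div_le_one ht0).2 ht.le
    have := rpow_one_add_le_one_add_mul_self (s := -(δ / t)) (p := 1 - ν) (by linarith)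
      (by linarith) (by linarith)
    rw [sub_div, div_self ht0.ne']
    rw [← sub_eq_add_neg] at this
    linarith
  have hnn : 0 ≤ ((t - δ) / t) ^ (1 - ν) * f (t - δ) :=
    mul_nonneg (by positivity) (hpos _ ⟨hu.le, sub_le_self t hδ0.le⟩)
  have hft := hpos t ⟨ht0.le, le_rfl⟩
  have hlast : c * (2 * f t * (δ ^ ν / ν)) ≤ f t := by nlinarith
  have e : (1 - ν) * δ / 2 / t = (1 - ν) * (δ / t) / 2 := by ring
  rw [e]
  linarith

end IsRelaxation

lemma integral_sub_rpow_mul_rpow_pow (hν : 0 < ν) {t : ℝ} (ht : 0 < t) (n : ℕ) :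
    ∫ s in 0..t, (t - s) ^ (ν - 1) * (s ^ ν) ^ n =
      (t ^ ν) ^ (n + 1) *
        (Real.Gamma ν * Real.Gamma (ν * n + 1) / Real.Gamma (ν * (n + 1 : ℕ) + 1)) := by
  have hn : 0 < ν * n + 1 := by positivity
  have h := Complex.betaIntegral_scaled ((ν * n + 1 : ℝ) : ℂ) (ν : ℂ) ht
  have hbeta : Complex.betaIntegral ((ν * n + 1 : ℝ) : ℂ) (ν : ℂ) =
      ((Real.Gamma (ν * n + 1) * Real.Gamma ν / Real.Gamma (ν * n + 1 + ν) : ℝ) : ℂ) := by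
    rw [Complex.betaIntegral_eq_Gamma_mul_div _ _ (by simpa using hn) (by simpa using hν),
      Complex.Gamma_ofReal, Complex.Gamma_ofReal, ← Complex.ofReal_add, Complex.Gamma_ofReal]
    push_cast
    rfl
  rw [hbeta] at h
  have hl : ∫ s in 0..t, (s : ℂ) ^ (((ν * n + 1 : ℝ) : ℂ) - 1) * ((t : ℂ) - s) ^ ((ν : ℂ) - 1) =
      ((∫ s in 0..t, (t - s) ^ (ν - 1) * (s ^ ν) ^ n : ℝ) : ℂ) := by
    rw [← intervalIntegral.integral_ofReal]
    refine intervalIntegral.integral_congr fun s hs => ?_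
    rw [uIcc_of_le ht.le] at hs
    have h1 : ((ν * n + 1 : ℝ) : ℂ) - 1 = ((ν * n : ℝ) : ℂ) := by push_cast; ring
    have h2 : (ν : ℂ) - 1 = ((ν - 1 : ℝ) : ℂ) := by push_cast; ring
    have h3 : (t : ℂ) - s = ((t - s : ℝ) : ℂ) := by push_cast; ring
    simp only [h1, h2, h3]
    rw [← Complex.ofReal_cpow hs.1, ← Complex.ofReal_cpow (sub_nonneg.2 hs.2),
      ← Complex.ofReal_mul, Real.rpow_mul_natCast hs.1, mul_comm]
  have hr : (t : ℂ) ^ (((ν * n + 1 : ℝ) : ℂ) + (ν : ℂ) - 1) = (((t ^ ν) ^ (n + 1) : ℝ) : ℂ) := by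
    have h1 : ((ν * n + 1 : ℝ) : ℂ) + (ν : ℂ) - 1 = ((ν * (n + 1 : ℕ) : ℝ) : ℂ) := by
      push_cast; ring
    rw [h1, ← Complex.ofReal_cpow ht.le, Real.rpow_mul_natCast ht.le]
  rw [hl, hr, ← Complex.ofReal_mul] at h
  rw [Complex.ofReal_injective h, mul_comm (Real.Gamma ν)]
  congr 3
  push_cast
  ring

lemma continuous_mittagLeffler_neg_rpow (hν : 0 < ν) :
    Continuous fun t : ℝ => mittagLeffler ν (-t ^ ν) :=
  (continuous_mittagLeffler hν).comp (Real.continuous_rpow_const hν.le).neg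

lemma isRelaxation_mittagLeffler (hν : 0 < ν) :
    IsRelaxation ν (Real.Gamma ν)⁻¹ fun t => mittagLeffler ν (-t ^ ν) := by
  refine ⟨continuous_mittagLeffler_neg_rpow hν, fun t ht => ?_⟩
  rcases ht.eq_or_lt with rfl | ht
  · simp [Real.zero_rpow hν.ne', mittagLeffler_zero hν]
  have hint := intervalIntegral.hasSum_integral_of_dominated_convergence (μ := volume)
    (a := 0) (b := t)
    (F := fun (n : ℕ) (s : ℝ) => (t - s) ^ (ν - 1) * ((-s ^ ν) ^ n / Real.Gamma (ν * n + 1)))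
    (f := fun s => (t - s) ^ (ν - 1) * mittagLeffler ν (-s ^ ν))
    (fun n s => (t - s) ^ (ν - 1) * ((t ^ ν) ^ n / Real.Gamma (ν * n + 1)))
    (fun n => by
      have h : Continuous fun s : ℝ => (-s ^ ν) ^ n / Real.Gamma (ν * n + 1) :=
        ((Real.continuous_rpow_const hν.le).neg.pow n).div_const _
      exact (intervalIntegrable_iff.1
        (intervalIntegrable_sub_rpow_mul hν h t 0 t)).aestronglyMeasurable)
    (fun n => .of_forall fun s hs => by
      rw [uIoc_of_le ht.le] at hs
      have hs0 := hs.1.le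
      have hts : 0 ≤ t - s := sub_nonneg.2 hs.2
      have hG := Gamma_mul_natCast_add_one_pos hν n
      rw [norm_mul, norm_div, norm_pow, norm_neg, Real.norm_of_nonneg (by positivity),
        Real.norm_of_nonneg (by positivity), Real.norm_of_nonneg hG.le]
      have := hs.2
      gcongr)
    (.of_forall fun s _ => (summable_mittagLeffler hν _).mul_left _)
    (by
      simp_rw [tsum_mul_left]
      exact (intervalIntegrable_sub_rpow hν t 0 t).mul_const _)
    (.of_forall fun s _ => (hasSum_mittagLeffler hν _).mul_left _)
  have hterm (n : ℕ) :
      ∫ s in 0..t, (t - s) ^ (ν - 1) * ((-s ^ ν) ^ n / Real.Gamma (ν * n + 1)) =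
      -Real.Gamma ν * ((-t ^ ν) ^ (n + 1) / Real.Gamma (ν * (n + 1 : ℕ) + 1)) := by
    have hG := (Gamma_mul_natCast_add_one_pos hν n).ne'
    have e (s : ℝ) : (t - s) ^ (ν - 1) * ((-s ^ ν) ^ n / Real.Gamma (ν * n + 1)) =
        (-1) ^ n / Real.Gamma (ν * n + 1) * ((t - s) ^ (ν - 1) * (s ^ ν) ^ n) := by
      rw [neg_pow]; ring
    simp_rw [e]
    rw [intervalIntegral.integral_const_mul, integral_sub_rpow_mul_rpow_pow hν ht,
      neg_pow (t ^ ν)]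
    field_simp
    ring
  simp_rw [hterm] at hint
  have hs := ((hasSum_nat_add_iff' 1).2 (hasSum_mittagLeffler hν (-t ^ ν))).mul_left
    (-Real.Gamma ν)
  have := hs.unique hint
  have hG := (Real.Gamma_pos_of_pos hν).ne'
  simp only [← this]
  simp
  field_simp
  ring

end Volterra

section LogAsymptotics

variable {ν : ℝ}

lemma tendsto_log_mittagLeffler_rpow_div (hν : 0 < ν) (hν1 : ν < 1) :
    Tendsto (fun y : ℝ => Real.log (mittagLeffler ν (y ^ ν)) / y) atTop (𝓝 1) := by
  have hlog : Tendsto (fun y : ℝ => Real.log (1 + y) / y) atTop (𝓝 0) := by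
    have h1 : Tendsto (fun y : ℝ => Real.log (1 + y) / (1 + y)) atTop (𝓝 0) :=
      (Real.isLittleO_log_id_atTop.tendsto_div_nhds_zero).comp
        (tendsto_atTop_add_const_left atTop (1 : ℝ) tendsto_id)
    have h2 : Tendsto (fun y : ℝ => 1 + y⁻¹) atTop (𝓝 (1 + 0)) :=
      tendsto_inv_atTop_zero.const_add 1
    have h3 := h1.mul h2
    rw [zero_mul] at h3
    refine h3.congr' ?_
    filter_upwards [eventually_gt_atTop 0] with y hy
    field_simp
    ring
  refine tendsto_order.2 ⟨fun l hl => ?_, fun u hu => ?_⟩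
  · filter_upwards [eventually_ge_atTop 1, hlog.eventually (gt_mem_nhds (sub_pos.2 hl))]
      with y hy hly
    have hy0 : 0 < y := by linarith
    have hE : 0 < mittagLeffler ν (y ^ ν) :=
      zero_lt_one.trans_le (one_le_mittagLeffler hν (by positivity))
    have h := Real.log_le_log (Real.exp_pos y) (exp_le_mul_mittagLeffler hν hν1 hy)
    rw [Real.log_exp, Real.log_mul (by positivity) hE.ne'] at h
    rw [div_lt_iff₀ hy0] at hly
    rw [lt_div_iff₀ hy0]
    linarith
  · obtain ⟨b, hb1, hbu⟩ := exists_between hu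
    have hC : 0 < (1 - b ^ (-ν))⁻¹ := inv_pos.2 (sub_pos.2 (rpow_neg_lt_one hν hb1))
    have hsmall : Tendsto (fun y : ℝ => Real.log (1 - b ^ (-ν))⁻¹ / y) atTop (𝓝 0) :=
      tendsto_const_nhds.div_atTop tendsto_id
    filter_upwards [eventually_gt_atTop 0, hsmall.eventually (gt_mem_nhds (sub_pos.2 hbu))]
      with y hy hly
    have hE : 0 < mittagLeffler ν (y ^ ν) :=
      zero_lt_one.trans_le (one_le_mittagLeffler hν (by positivity))
    have h := Real.log_le_log hE (mittagLeffler_rpow_le hν hb1 hy.le)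
    rw [Real.log_mul (Real.exp_pos _).ne' hC.ne', Real.log_exp] at h
    rw [div_lt_iff₀ hy] at hly ⊢
    linarith

lemma tendsto_log_mittagLeffler_neg_rpow_div (hν : 0 < ν) (hν1 : ν < 1) :
    Tendsto (fun y : ℝ => Real.log (mittagLeffler ν (-y ^ ν)) / y) atTop (𝓝 0) := by
  have hf := isRelaxation_mittagLeffler hν
  have hc : 0 < (Real.Gamma ν)⁻¹ := inv_pos.2 (Real.Gamma_pos_of_pos hν)
  obtain ⟨δ, hδ0, hδ⟩ : ∃ δ : ℝ, 0 < δ ∧ (Real.Gamma ν)⁻¹ * (δ ^ ν / ν) ≤ 1 / 2 := by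
    have h : Tendsto (fun δ : ℝ => (Real.Gamma ν)⁻¹ * (δ ^ ν / ν)) (𝓝[>] 0) (𝓝 0) := by
      have := (((Real.continuous_rpow_const hν.le).tendsto 0).div_const ν).const_mul
        (Real.Gamma ν)⁻¹
      rw [Real.zero_rpow hν.ne', zero_div, mul_zero] at this
      exact this.mono_left nhdsWithin_le_nhds
    obtain ⟨δ, h1, h2⟩ := ((h.eventually (gt_mem_nhds one_half_pos)).and
      self_mem_nhdsWithin).exists
    exact ⟨δ, h2, h1.le⟩
  have hC : 0 < (1 - ν) * δ / 2 := by have := sub_pos.2 hν1; positivity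
  have hlow : Tendsto (fun y : ℝ => Real.log ((1 - ν) * δ / 2) / y - Real.log y / y) atTop
      (𝓝 0) := by
    have h1 : Tendsto (fun y : ℝ => Real.log ((1 - ν) * δ / 2) / y) atTop (𝓝 0) :=
      tendsto_const_nhds.div_atTop tendsto_id
    have h2 : Tendsto (fun y : ℝ => Real.log y / y) atTop (𝓝 0) :=
      Real.isLittleO_log_id_atTop.tendsto_div_nhds_zero
    simpa using h1.sub h2
  refine tendsto_of_tendsto_of_tendsto_of_le_of_le' hlow tendsto_const_nhds ?_ ?_
  · filter_upwards [eventually_gt_atTop δ] with y hy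
    have hy0 : 0 < y := hδ0.trans hy
    rw [← sub_div, ← Real.log_div hC.ne' hy0.ne']
    have := Real.log_le_log (by positivity) (hf.div_le_apply hν hν1 hc.le hδ0 hδ hy)
    gcongr
  · filter_upwards [eventually_gt_atTop 0] with y hy
    exact div_nonpos_of_nonpos_of_nonneg (Real.log_nonpos
      (hf.pos hν hν1 hc.le hδ0 hδ hy.le).le (hf.le_one hν hν1 hc.le hδ0 hδ hy.le)) hy.le

lemma tendsto_mul_log_mittagLeffler (hν : 0 < ν) (hν1 : ν < 1) {a g : ℝ → ℝ} {c : ℝ} (hc : c ≠ 0)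
    (ha : Tendsto a atTop (𝓝[>] 0)) (hg : Tendsto g atTop (𝓝 c)) :
    Tendsto (fun t => a t * Real.log (mittagLeffler ν (g t * a t ^ (-ν)))) atTop
      (𝓝 ((max c 0) ^ (1 / ν))) := by
  have hinv := tendsto_inv_nhdsGT_zero.comp ha
  have hy : Tendsto (fun t => |g t| ^ (1 / ν)) atTop (𝓝 (|c| ^ (1 / ν))) :=
    hg.abs.rpow_const (Or.inr (by positivity))
  have hy' : Tendsto (fun t => |g t| ^ (1 / ν) * (a t)⁻¹) atTop atTop :=
    hy.pos_mul_atTop (by positivity) hinv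
  have hpow {t : ℝ} (hat : 0 < a t) : (|g t| ^ (1 / ν) * (a t)⁻¹) ^ ν = |g t| * a t ^ (-ν) := by
    rw [Real.mul_rpow (by positivity) (by positivity), ← Real.rpow_mul (abs_nonneg _),
      one_div_mul_cancel hν.ne', Real.rpow_one, Real.rpow_neg hat.le, Real.inv_rpow hat.le]
  have ha_pos : ∀ᶠ t in atTop, 0 < a t := ha.eventually self_mem_nhdsWithin
  rcases hc.lt_or_gt with hc | hc
  · have h := hy.mul ((tendsto_log_mittagLeffler_neg_rpow_div hν hν1).comp hy')
    rw [mul_zero] at h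
    rw [max_eq_right hc.le, Real.zero_rpow (by positivity)]
    refine h.congr' ?_
    filter_upwards [ha_pos, hg.eventually (gt_mem_nhds hc)] with t hat hgt
    simp only [Function.comp_apply]
    rw [hpow hat, abs_of_neg hgt, neg_mul, neg_neg]
    have : (0 : ℝ) < (-g t) ^ (1 / ν) := Real.rpow_pos_of_pos (neg_pos.2 hgt) _
    field_simp
  · have h := hy.mul ((tendsto_log_mittagLeffler_rpow_div hν hν1).comp hy')
    rw [mul_one, abs_of_pos hc] at h
    rw [max_eq_left hc.le]
    refine h.congr' ?_
    filter_upwards [ha_pos, hg.eventually (lt_mem_nhds hc)] with t hat hgt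
    simp only [Function.comp_apply]
    rw [hpow hat, abs_of_pos hgt]
    have : (0 : ℝ) < g t ^ (1 / ν) := Real.rpow_pos_of_pos hgt _
    field_simp

end LogAsymptotics

theorem mittagLeffler_MD_limit_noncentered (ν : ℝ) (hν : ν ∈ Set.Ioo (0 : ℝ) 1)
    (m : ℝ) (hm : m ≠ 0) (κ : ℝ → ℝ) (hκ0 : κ 0 = 0)
    (hκ : Tendsto (fun u : ℝ => κ u / u) (nhdsWithin 0 {(0 : ℝ)}ᶜ) (nhds m))
    (a : ℝ → ℝ) (ha_pos : ∀ t : ℝ, 0 < t → 0 < a t)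
    (ha0 : Tendsto a atTop (nhds 0))
    (hat : Tendsto (fun t : ℝ => t * a t) atTop atTop)
    (θ : ℝ) :
    Tendsto (fun t : ℝ =>
        a t * Real.log (mittagLeffler ν (κ (θ * (a t * t) ^ (-ν)) * t ^ ν)))
      atTop (nhds ((max (m * θ) 0) ^ (1 / ν))) := by
  obtain ⟨hν0, hν1⟩ := hν
  rcases eq_or_ne θ 0 with rfl | hθ
  · simp [hκ0, mittagLeffler_zero hν0, Real.zero_rpow (inv_ne_zero hν0.ne')]
  have ha : Tendsto a atTop (𝓝[>] 0) := tendsto_nhdsWithin_iff.2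
    ⟨ha0, (eventually_gt_atTop 0).mono fun t ht => ha_pos t ht⟩
  have hu : Tendsto (fun t : ℝ => θ * (a t * t) ^ (-ν)) atTop (𝓝[≠] 0) := by
    refine tendsto_nhdsWithin_iff.2 ⟨?_, ?_⟩
    · have h := ((tendsto_rpow_neg_atTop hν0).comp hat).const_mul θ
      rw [mul_zero] at h
      exact h.congr fun t => by simp [mul_comm]
    · filter_upwards [eventually_gt_atTop 0] with t ht
      have := ha_pos t ht
      exact mul_ne_zero hθ (by positivity)
  refine (tendsto_mul_log_mittagLeffler hν0 hν1 (mul_ne_zero hm hθ) ha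
    ((hκ.comp hu).mul_const θ)).congr' ?_
  filter_upwards [eventually_gt_atTop 0] with t ht
  have hat := ha_pos t ht
  have e : κ (θ * (a t * t) ^ (-ν)) / (θ * (a t * t) ^ (-ν)) * θ * a t ^ (-ν) =
      κ (θ * (a t * t) ^ (-ν)) * t ^ ν := by
    have h : (a t * t) ^ (-ν) * t ^ ν = a t ^ (-ν) := by
      rw [Real.mul_rpow hat.le ht.le, mul_assoc, ← Real.rpow_add ht]
      simp
    have hne : (a t * t) ^ (-ν) ≠ 0 := by positivity
    rw [← h]
    field_simp
  simp only [Function.comp_apply, e]
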